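/- Let A, B, C be three affinely independent points in the Euclidean plane. Then the following are equivalent: (i) there exist a point O ∈ ℝ², a constant c > 0, and a constant m such that W(P) = c·dist(P, O)² + m for all P ∈ ℝ² (i.e. every nonempty locus {P : W(P) = k} with k > m is a circle centered at O); (ii) the triangle is equilateral, i.e. dist A B = dist B C = dist C A. -/

import Mathlib

noncomputable section

/-- The point `(x, y)` of the Euclidean plane `ℝ²`. -/
def pt (x y : ℝ) : EuclideanSpace ℝ (Fin 2) :=
  (WithLp.equiv 2 (Fin 2 → ℝ)).symm ![x, y]

/-- The line through `X` and `Y`, i.e. the affine span of `{X, Y}`, as a set. -/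
def lineThrough (X Y : EuclideanSpace ℝ (Fin 2)) : Set (EuclideanSpace ℝ (Fin 2)) :=
  (affineSpan ℝ {X, Y} : AffineSubspace ℝ (EuclideanSpace ℝ (Fin 2)))

/-- The distance sum function of the triangle `ABC`:
`V(P) = dist(P, line BC) + dist(P, line CA) + dist(P, line AB)`. -/
def vSum (A B C P : EuclideanSpace ℝ (Fin 2)) : ℝ :=
  Metric.infDist P (lineThrough B C) + Metric.infDist P (lineThrough C A) +
    Metric.infDist P (lineThrough A B)

/-- The squared-distance sum function of the triangle `ABC`:
`W(P) = dist(P, line BC)² + dist(P, line CA)² + dist(P, line AB)²`. -/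
def wSum (A B C P : EuclideanSpace ℝ (Fin 2)) : ℝ :=
  Metric.infDist P (lineThrough B C) ^ 2 + Metric.infDist P (lineThrough C A) ^ 2 +
    Metric.infDist P (lineThrough A B) ^ 2

/-- The cross product `(Q - P) × (Y - X)`. -/
def planeCross (P Q X Y : EuclideanSpace ℝ (Fin 2)) : ℝ :=
  (Q 0 - P 0) * (Y 1 - X 1) - (Q 1 - P 1) * (Y 0 - X 0)

theorem dist_sq_eq_coords (P Q : EuclideanSpace ℝ (Fin 2)) :
    dist P Q ^ 2 = (P 0 - Q 0) ^ 2 + (P 1 - Q 1) ^ 2 := by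
  rw [EuclideanSpace.dist_sq_eq, Fin.sum_univ_two, Real.dist_eq, Real.dist_eq, sq_abs, sq_abs]

theorem dist_lineMap_sq_mul (P X Y : EuclideanSpace ℝ (Fin 2)) (t : ℝ) :
    dist P (AffineMap.lineMap X Y t) ^ 2 * dist X Y ^ 2 = planeCross X P X Y ^ 2 +
      ((P 0 - X 0) * (Y 0 - X 0) + (P 1 - X 1) * (Y 1 - X 1) - t * dist X Y ^ 2) ^ 2 := by
  simp only [dist_sq_eq_coords, planeCross, AffineMap.lineMap_apply, vsub_eq_sub, vadd_eq_add,
    PiLp.add_apply, PiLp.smul_apply, PiLp.sub_apply, smul_eq_mul]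
  ring

theorem infDist_lineThrough_sq {X Y : EuclideanSpace ℝ (Fin 2)} (h : X ≠ Y)
    (P : EuclideanSpace ℝ (Fin 2)) :
    Metric.infDist P (lineThrough X Y) ^ 2 = planeCross X P X Y ^ 2 / dist X Y ^ 2 := by
  have hl : 0 < dist X Y := dist_pos.2 h
  have hd : Metric.infDist P (lineThrough X Y) = |planeCross X P X Y| / dist X Y := by
    apply le_antisymm
    · set t := ((P 0 - X 0) * (Y 0 - X 0) + (P 1 - X 1) * (Y 1 - X 1)) / dist X Y ^ 2 with ht
      refine (Metric.infDist_le_dist_of_mem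
        (AffineMap.lineMap_mem_affineSpan_pair t X Y)).trans ?_
      have key := dist_lineMap_sq_mul P X Y t
      rw [ht, div_mul_cancel₀ _ (by positivity), sub_self, ← ht] at key
      rw [le_div_iff₀ hl]
      exact (le_abs_self _).trans (sq_le_sq.1 (by rw [mul_pow]; linarith))
    · refine (Metric.le_infDist ⟨X, left_mem_affineSpan_pair ℝ X Y⟩).2 ?_
      intro Q hQ
      obtain ⟨t, rfl⟩ := mem_affineSpan_pair_iff_exists_lineMap_eq.1 hQ
      have key := dist_lineMap_sq_mul P X Y t
      rw [div_le_iff₀ hl]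
      refine abs_le_of_sq_le_sq ?_ (mul_nonneg dist_nonneg hl.le)
      rw [mul_pow, key]
      exact le_add_of_nonneg_right (sq_nonneg _)
  rw [hd, div_pow, sq_abs]

theorem planeCross_ne_zero {A B C : EuclideanSpace ℝ (Fin 2)}
    (hind : AffineIndependent ℝ ![A, B, C]) : planeCross A B A C ≠ 0 := by
  intro hD
  have hAB : A ≠ B := fun h => by simpa using hind.injective.ne (show (0 : Fin 3) ≠ 1 by decide) h
  have hl : dist A B ^ 2 ≠ 0 := pow_ne_zero _ (dist_ne_zero.2 hAB)
  refine affineIndependent_iff_not_collinear_set.1 hind ?_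
  set t := ((C 0 - A 0) * (B 0 - A 0) + (C 1 - A 1) * (B 1 - A 1)) / dist A B ^ 2 with ht
  have key := dist_lineMap_sq_mul C A B t
  have hD' : planeCross A C A B = 0 := by unfold planeCross at *; linarith
  rw [ht, div_mul_cancel₀ _ hl, sub_self, hD', ← ht] at key
  have hC : C = AffineMap.lineMap A B t := by
    rw [← dist_eq_zero]
    simpa [hAB] using key
  have hmem : C ∈ affineSpan ℝ {A, B} := hC ▸ AffineMap.lineMap_mem_affineSpan_pair t A B
  have := collinear_insert_of_mem_affineSpan_pair hmem
  convert this using 1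
  ext; simp; tauto

theorem wSum_eq {A B C : EuclideanSpace ℝ (Fin 2)} (hAB : A ≠ B) (hBC : B ≠ C) (hCA : C ≠ A)
    (P : EuclideanSpace ℝ (Fin 2)) :
    wSum A B C P = planeCross B P B C ^ 2 / dist B C ^ 2 + planeCross C P C A ^ 2 / dist C A ^ 2 +
      planeCross A P A B ^ 2 / dist A B ^ 2 := by
  rw [wSum, infDist_lineThrough_sq hAB, infDist_lineThrough_sq hBC, infDist_lineThrough_sq hCA]

theorem wSum_second_difference {A B C : EuclideanSpace ℝ (Fin 2)}
    (hAB : A ≠ B) (hBC : B ≠ C) (hCA : C ≠ A) (X Y : EuclideanSpace ℝ (Fin 2)) :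
    wSum A B C (X + (Y - X)) + wSum A B C (X - (Y - X)) - 2 * wSum A B C X =
      2 * (planeCross X Y B C ^ 2 / dist B C ^ 2 + planeCross X Y C A ^ 2 / dist C A ^ 2 +
        planeCross X Y A B ^ 2 / dist A B ^ 2) := by
  simp only [wSum_eq hAB hBC hCA, planeCross, PiLp.add_apply, PiLp.sub_apply]
  ring

theorem eq_of_balance {x y z d c : ℝ} (hx : 0 < x) (hy : 0 < y) (hz : 0 < z) (hd : 0 < d)
    (h₁ : d / y + d / z = c * x) (h₂ : d / x + d / z = c * y) : x = y := by
  have e₁ : d / y * y = d := div_mul_cancel₀ _ hy.ne'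
  have e₂ : d / x * x = d := div_mul_cancel₀ _ hx.ne'
  have h₃ : d / z * (x - y) = 0 := by
    linear_combination x * h₂ - y * h₁ - e₂ + e₁
  have hz' : d / z ≠ 0 := (div_pos hd hz).ne'
  linarith [(mul_eq_zero.1 h₃).resolve_left hz']

theorem dist_sq_eq_of_wSum {A B C O : EuclideanSpace ℝ (Fin 2)} {c m : ℝ}
    (hD : planeCross A B A C ≠ 0) (hAB : A ≠ B) (hBC : B ≠ C) (hCA : C ≠ A)
    (h : ∀ P, wSum A B C P = c * dist P O ^ 2 + m) :
    dist A B ^ 2 = dist B C ^ 2 ∧ dist B C ^ 2 = dist C A ^ 2 := by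
  have hq (X Y : EuclideanSpace ℝ (Fin 2)) :
      planeCross X Y B C ^ 2 / dist B C ^ 2 + planeCross X Y C A ^ 2 / dist C A ^ 2 +
        planeCross X Y A B ^ 2 / dist A B ^ 2 = c * dist X Y ^ 2 := by
    have key := wSum_second_difference hAB hBC hCA X Y
    simp only [h, dist_sq_eq_coords _ O, PiLp.add_apply, PiLp.sub_apply] at key
    rw [dist_sq_eq_coords X Y]
    linear_combination -key / 2
  have hAB' := dist_pos.2 hAB
  have hBC' := dist_pos.2 hBC
  have hCA' := dist_pos.2 hCA
  have hd : 0 < planeCross A B A C ^ 2 := by positivity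
  have c₀ (X Y : EuclideanSpace ℝ (Fin 2)) : planeCross X Y X Y = 0 := by
    unfold planeCross; ring
  have c₁ : planeCross B C C A ^ 2 = planeCross A B A C ^ 2 := by unfold planeCross; ring
  have c₂ : planeCross B C A B ^ 2 = planeCross A B A C ^ 2 := by unfold planeCross; ring
  have c₃ : planeCross C A B C ^ 2 = planeCross A B A C ^ 2 := by unfold planeCross; ring
  have c₄ : planeCross C A A B ^ 2 = planeCross A B A C ^ 2 := by unfold planeCross; ring
  have c₅ : planeCross A B B C ^ 2 = planeCross A B A C ^ 2 := by unfold planeCross; ring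
  have c₆ : planeCross A B C A ^ 2 = planeCross A B A C ^ 2 := by unfold planeCross; ring
  have h₁ := hq B C
  have h₂ := hq C A
  have h₃ := hq A B
  simp only [c₀, c₁, c₂, c₃, c₄, c₅, c₆] at h₁ h₂ h₃
  exact ⟨eq_of_balance (c := c) (by positivity) (by positivity) (pow_pos hCA' 2) hd
      (by linear_combination h₃) (by linear_combination h₁),
    eq_of_balance (c := c) (by positivity) (by positivity) (pow_pos hAB' 2) hd
      (by linear_combination h₁) (by linear_combination h₂)⟩

/-- If `a`, `b` are plane vectors of equal length enclosing the angle `2π/3`, then the sum of the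
squared cross products of a vector with `a`, `b` and `a + b` is a multiple of its squared norm. -/
theorem sum_cross_sq_of_equilateral {a₁ a₂ b₁ b₂ l : ℝ} (hl : 0 < l)
    (ha : a₁ ^ 2 + a₂ ^ 2 = l) (hb : b₁ ^ 2 + b₂ ^ 2 = l) (hab : a₁ * b₁ + a₂ * b₂ = -l / 2)
    (x y : ℝ) :
    (x * a₂ - y * a₁) ^ 2 + (x * b₂ - y * b₁) ^ 2 + (x * (a₂ + b₂) - y * (a₁ + b₁)) ^ 2 =
      3 / 2 * l * (x ^ 2 + y ^ 2) := by
  set t := (a₁ * b₂ - a₂ * b₁) / l with ht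
  have htl : t * l = a₁ * b₂ - a₂ * b₁ := div_mul_cancel₀ _ hl.ne'
  have h₁ : b₁ = -a₁ / 2 - t * a₂ := by
    apply mul_right_cancel₀ hl.ne'
    linear_combination (-b₁) * ha + a₁ * hab + a₂ * htl
  have h₂ : b₂ = -a₂ / 2 + t * a₁ := by
    apply mul_right_cancel₀ hl.ne'
    linear_combination (-b₂) * ha + a₂ * hab - a₁ * htl
  have h₃ : t ^ 2 = 3 / 4 := by
    apply mul_right_cancel₀ hl.ne'
    rw [h₁, h₂] at hb
    linear_combination hb - (1 / 4 + t ^ 2) * ha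
  rw [h₁, h₂, ← ha]
  linear_combination 2 * (x * a₁ + y * a₂) ^ 2 * h₃

theorem wSum_of_equilateral {A B C : EuclideanSpace ℝ (Fin 2)} (hAB : A ≠ B)
    (h₁ : dist A B = dist B C) (h₂ : dist B C = dist C A) (P : EuclideanSpace ℝ (Fin 2)) :
    wSum A B C P = 3 / 2 * dist P ((3⁻¹ : ℝ) • (A + B + C)) ^ 2 +
      planeCross A B A C ^ 2 / (3 * dist A B ^ 2) := by
  have hpos := dist_pos.2 hAB
  have hBC : B ≠ C := dist_pos.1 (h₁ ▸ hpos)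
  have hCA : C ≠ A := dist_pos.1 (h₂ ▸ h₁ ▸ hpos)
  have hl : 0 < dist A B ^ 2 := by positivity
  have e₁ : dist B C ^ 2 = dist A B ^ 2 := by rw [h₁]
  have e₂ : dist C A ^ 2 = dist A B ^ 2 := by rw [h₁, h₂]
  rw [wSum_eq hAB hBC hCA, e₁, e₂]
  rw [dist_sq_eq_coords P]
  simp only [PiLp.smul_apply, PiLp.add_apply, smul_eq_mul]
  have ha := dist_sq_eq_coords A B
  rw [dist_sq_eq_coords B C] at e₁
  rw [dist_sq_eq_coords C A] at e₂
  generalize dist A B ^ 2 = l at *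
  have key := sum_cross_sq_of_equilateral (a₁ := B 0 - A 0) (a₂ := B 1 - A 1)
    (b₁ := C 0 - B 0) (b₂ := C 1 - B 1) hl (by linear_combination -ha)
    (by linear_combination e₁) (by linear_combination (e₂ - e₁ + ha) / 2)
    (P 0 - 3⁻¹ * (A 0 + B 0 + C 0)) (P 1 - 3⁻¹ * (A 1 + B 1 + C 1))
  unfold planeCross
  field_simp
  linear_combination 6 * key

/-- **Conclusion 1.** The squared-distance sum function of a triangle has the form
`W(P) = c·dist(P,O)² + m` (so that its level sets are circles centered at `O`) if and only
if the triangle is equilateral. -/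
theorem stmt_15 (A B C : EuclideanSpace ℝ (Fin 2))
    (hind : AffineIndependent ℝ ![A, B, C]) :
    (∃ (O : EuclideanSpace ℝ (Fin 2)) (c m : ℝ), 0 < c ∧
        ∀ P : EuclideanSpace ℝ (Fin 2), wSum A B C P = c * dist P O ^ 2 + m) ↔
      (dist A B = dist B C ∧ dist B C = dist C A) := by
  have hD := planeCross_ne_zero hind
  have hAB : A ≠ B := by rintro rfl; exact hD (by unfold planeCross; ring)
  have hBC : B ≠ C := by rintro rfl; exact hD (by unfold planeCross; ring)
  have hCA : C ≠ A := by rintro rfl; exact hD (by unfold planeCross; ring)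
  constructor
  · rintro ⟨O, c, m, -, h⟩
    obtain ⟨h₁, h₂⟩ := dist_sq_eq_of_wSum hD hAB hBC hCA h
    exact ⟨(pow_left_inj₀ dist_nonneg dist_nonneg two_ne_zero).1 h₁,
      (pow_left_inj₀ dist_nonneg dist_nonneg two_ne_zero).1 h₂⟩
  · rintro ⟨h₁, h₂⟩
    exact ⟨_, _, _, by norm_num, wSum_of_equilateral hAB h₁ h₂⟩
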